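/- There exists a First-in-first-out Routing Game that admits no pure Nash equilibrium: in particular the 8-agent game of Figure 2 (a pursuer–evader construction) has no strategy profile from which no agent can strictly improve its total delay by a unilateral deviation. -/

import Mathlib

/-!  A formal model of First-in-first-out Routing Games (FROGs).

A FROG is a finite digraph whose edges carry a capacity `c e ≥ 1` and a fixed
delay `d e ≥ 0`, together with `n` agents, each having a source, a sink, a
starting time, and a tie-breaking priority (`prio i < prio j` means `i ≻ j`).
Strategies are simple directed paths from source to sink.  The FIFO dynamics
are axiomatized by the predicate `IsFIFO` on executions (join/enter times for
every agent and every edge of its path). -/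

structure FROG where
  nV : ℕ
  E : Finset (Fin nV × Fin nV)
  c : Fin nV × Fin nV → ℕ
  d : Fin nV × Fin nV → ℕ
  n : ℕ
  src : Fin n → Fin nV
  sink : Fin n → Fin nV
  start : Fin n → ℕ
  prio : Fin n → ℕ
  prio_inj : Function.Injective prio
  c_pos : ∀ e ∈ E, 1 ≤ c e

namespace FROG

/-- The type of (potential) edges of the digraph of `Γ`. -/
abbrev Edge (Γ : FROG) := Fin Γ.nV × Fin Γ.nV

/-- `IsPathFrom Γ u v p`: the list of edges `p` is a directed path from `u` to `v`
in the digraph of `Γ`. -/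
def IsPathFrom (Γ : FROG) : Fin Γ.nV → Fin Γ.nV → List Γ.Edge → Prop
  | u, v, [] => u = v
  | u, v, e :: p => e.1 = u ∧ e ∈ Γ.E ∧ Γ.IsPathFrom e.2 v p

/-- A path starting at `u` is simple if it visits no vertex twice. -/
def IsSimple (Γ : FROG) (u : Fin Γ.nV) (p : List Γ.Edge) : Prop :=
  (u :: p.map Prod.snd).Nodup

/-- The strategy set of agent `i`: simple directed paths from its source to its sink. -/
def Strat (Γ : FROG) (i : Fin Γ.n) :=
  {p : List Γ.Edge // Γ.IsPathFrom (Γ.src i) (Γ.sink i) p ∧ Γ.IsSimple (Γ.src i) p}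

/-- A strategy profile: one simple source-sink path per agent. -/
abbrev Profile (Γ : FROG) := ∀ i : Fin Γ.n, Γ.Strat i

/-- An agent is degenerate when it has a unique strategy. -/
def Degenerate (Γ : FROG) (j : Fin Γ.n) : Prop := ∀ s s' : Γ.Strat j, s = s'

variable {Γ : FROG}

/-- The `k`-th edge of the path of agent `i` in profile `π`. -/
def edgeAt (π : Γ.Profile) (i : Fin Γ.n) (k : Fin (π i).val.length) : Γ.Edge :=
  (π i).val.get k

/-- An execution records, for each agent `i` and each edge of its path, the time
at which `i` joins the FIFO queue of that edge and the time at which it leaves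
the queue and enters the edge. -/
structure Execution (π : Γ.Profile) where
  join : ∀ i : Fin Γ.n, Fin (π i).val.length → ℕ
  enter : ∀ i : Fin Γ.n, Fin (π i).val.length → ℕ

/-- `Ahead π ex j l i k`: in execution `ex`, agent `j` (at the `l`-th edge of its
path) is queued ahead of agent `i` (at the `k`-th edge of its path) on the same
edge: it joined strictly earlier, or at the same time step with higher priority. -/
def Ahead (π : Γ.Profile) (ex : Execution π) (j : Fin Γ.n) (l : Fin (π j).val.length)
    (i : Fin Γ.n) (k : Fin (π i).val.length) : Prop :=
  edgeAt π j l = edgeAt π i k ∧ (j ≠ i ∨ l.val ≠ k.val) ∧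
    (ex.join j l < ex.join i k ∨ (ex.join j l = ex.join i k ∧ Γ.prio j < Γ.prio i))

/-- The FIFO dynamics: agents start on the first edge of their path at their
starting time; queue joining times are enter time plus fixed delay of the
previous edge; the queue discipline never lets an agent overtake an agent ahead
of it; at each time step at most `c e` agents enter `e`; and service is eager:
an agent still waiting at time `t` does so only because `c e` agents ahead of
it enter the edge at time `t`. -/
structure IsFIFO (π : Γ.Profile) (ex : Execution π) : Prop where
  join_start : ∀ i (h : 0 < (π i).val.length), ex.join i ⟨0, h⟩ = Γ.start i
  join_le_enter : ∀ i k, ex.join i k ≤ ex.enter i k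
  transit : ∀ i (k : Fin (π i).val.length) (h : k.val + 1 < (π i).val.length),
    ex.join i ⟨k.val + 1, h⟩ = ex.enter i k + Γ.d (edgeAt π i k)
  no_overtake : ∀ j l i k, Ahead π ex j l i k → ex.enter j l ≤ ex.enter i k
  capacity : ∀ (e : Γ.Edge) (t : ℕ),
    Nat.card {p : Σ i : Fin Γ.n, Fin (π i).val.length //
      edgeAt π p.1 p.2 = e ∧ ex.enter p.1 p.2 = t} ≤ Γ.c e
  eager : ∀ i k (t : ℕ), ex.join i k ≤ t → t < ex.enter i k →
    Γ.c (edgeAt π i k) ≤ Nat.card {p : Σ j : Fin Γ.n, Fin (π j).val.length //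
      Ahead π ex p.1 p.2 i k ∧ ex.enter p.1 p.2 = t}

/-- Waiting time of agent `i` in the queue of the `k`-th edge of its path. -/
def waitTime (π : Γ.Profile) (ex : Execution π) (i : Fin Γ.n)
    (k : Fin (π i).val.length) : ℕ :=
  ex.enter i k - ex.join i k

/-- Total delay of agent `i`: sum over the edges of its path of the waiting
time in the queue plus the fixed delay. -/
def cost (π : Γ.Profile) (ex : Execution π) (i : Fin Γ.n) : ℕ :=
  ∑ k : Fin (π i).val.length, (waitTime π ex i k + Γ.d (edgeAt π i k))

/-- The total delay `C_i(π)` of agent `i` under profile `π` (via the FIFO execution). -/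
noncomputable def delay (π : Γ.Profile) (i : Fin Γ.n) : ℕ :=
  sInf {t | ∃ ex : Execution π, IsFIFO π ex ∧ cost π ex i = t}

/-- Pure Nash equilibrium: no agent can strictly decrease its total delay by a
unilateral deviation to another simple source-sink path. -/
def IsPNE (π : Γ.Profile) : Prop :=
  ∀ (i : Fin Γ.n) (p' : Γ.Strat i), delay π i ≤ delay (Function.update π i p') i

end FROG

namespace FROG

section Paths

variable (Γ : FROG)

instance decidableIsPathFrom :
    ∀ (u v : Fin Γ.nV) (p : List Γ.Edge), Decidable (Γ.IsPathFrom u v p)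
  | u, v, [] => inferInstanceAs (Decidable (u = v))
  | u, v, e :: p =>
    haveI := decidableIsPathFrom e.2 v p
    inferInstanceAs (Decidable (e.1 = u ∧ e ∈ Γ.E ∧ Γ.IsPathFrom e.2 v p))

instance decidableIsSimple (u : Fin Γ.nV) (p : List Γ.Edge) : Decidable (Γ.IsSimple u p) :=
  inferInstanceAs (Decidable (u :: p.map Prod.snd).Nodup)

/-- The paths from `u` to `v` with at most `fuel` edges that stop at the first visit of `v`,
never repeat a vertex after `u`, and avoid the vertices in `visited`. -/
def boundedPaths (v : Fin Γ.nV) : ℕ → List (Fin Γ.nV) → Fin Γ.nV → List (List Γ.Edge)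
  | 0, _, u => if u = v then [[]] else []
  | fuel + 1, visited, u =>
    if u = v then [[]] else
      ((List.finRange Γ.nV).filter fun w => (u, w) ∈ Γ.E ∧ w ∉ visited).flatMap fun w =>
        (boundedPaths v fuel (w :: visited) w).map ((u, w) :: ·)

variable {Γ}

theorem IsPathFrom.sink_mem {u v : Fin Γ.nV} {p : List Γ.Edge} (h : Γ.IsPathFrom u v p) :
    v ∈ u :: p.map Prod.snd := by
  induction p generalizing u with
  | nil => exact List.mem_singleton.2 (Eq.symm h)
  | cons e p ih => exact List.mem_cons_of_mem _ (ih h.2.2)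

theorem mem_boundedPaths {u v : Fin Γ.nV} {p : List Γ.Edge} {fuel : ℕ}
    {visited : List (Fin Γ.nV)} (hp : Γ.IsPathFrom u v p) (hs : Γ.IsSimple u p)
    (hv : ∀ w ∈ p.map Prod.snd, w ∉ visited) (hl : p.length ≤ fuel) :
    p ∈ Γ.boundedPaths v fuel visited u := by
  induction p generalizing u fuel visited with
  | nil =>
    have huv : u = v := hp
    cases fuel <;> simp [boundedPaths, huv]
  | cons e p ih =>
    obtain ⟨he, heE, hp⟩ := hp
    obtain ⟨a, b⟩ := e
    obtain rfl : a = u := he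
    have hs' : a ∉ b :: p.map Prod.snd ∧ (b :: p.map Prod.snd).Nodup := List.nodup_cons.1 hs
    have hne : a ≠ v := fun h => hs'.1 (h ▸ hp.sink_mem)
    obtain ⟨hb, hp'⟩ := List.forall_mem_cons.1 hv
    cases fuel with
    | zero => simp at hl
    | succ fuel =>
      rw [boundedPaths, if_neg hne, List.mem_flatMap]
      refine ⟨b, by simpa using ⟨heE, hb⟩, List.mem_map_of_mem (ih hp hs'.2 ?_ (by simpa using hl))⟩
      intro w hw
      rw [List.mem_cons, not_or]
      exact ⟨fun h => (List.nodup_cons.1 hs'.2).1 (h ▸ hw), hp' w hw⟩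

/-- Every strategy is found by the bounded search. -/
theorem Strat.mem_boundedPaths {i : Fin Γ.n} (σ : Γ.Strat i) :
    σ.val ∈ Γ.boundedPaths (Γ.sink i) Γ.nV [] (Γ.src i) := by
  refine FROG.mem_boundedPaths σ.2.1 σ.2.2 (by simp) ?_
  have h := List.Nodup.length_le_card (List.nodup_cons.1 σ.2.2).2
  simpa using h

end Paths

section Dynamics

variable {Γ : FROG} {π : Γ.Profile} {ex : Execution π}

instance decidableAhead (j : Fin Γ.n) (l : Fin (π j).val.length) (i : Fin Γ.n)
    (k : Fin (π i).val.length) : Decidable (Ahead π ex j l i k) := by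
  unfold Ahead
  infer_instance

/-- On an edge of capacity one, an agent ahead of another enters strictly earlier. -/
theorem IsFIFO.enter_lt_of_ahead (h : IsFIFO π ex) {j : Fin Γ.n} {l : Fin (π j).val.length}
    {i : Fin Γ.n} {k : Fin (π i).val.length} (hc : Γ.c (edgeAt π i k) = 1)
    (ha : Ahead π ex j l i k) : ex.enter j l < ex.enter i k := by
  refine lt_of_le_of_ne (h.no_overtake j l i k ha) fun heq => ?_
  have hcard := h.capacity (edgeAt π i k) (ex.enter i k)
  rw [hc, Finite.card_le_one_iff_subsingleton] at hcard
  have := congrArg Subtype.val (hcard.elim ⟨⟨j, l⟩, ha.1, heq⟩ ⟨⟨i, k⟩, rfl, rfl⟩)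
  cases this
  simpa using ha.2.1

/-- An agent does not wait if everyone else using the edge comes later or has already left. -/
theorem IsFIFO.enter_eq_join (h : IsFIFO π ex) {i : Fin Γ.n} {k : Fin (π i).val.length}
    (hc : 1 ≤ Γ.c (edgeAt π i k))
    (hfree : ∀ j l, edgeAt π j l = edgeAt π i k → (j ≠ i ∨ l.val ≠ k.val) →
      ex.join i k < ex.join j l ∨ ex.enter j l < ex.join i k) :
    ex.enter i k = ex.join i k := by
  by_contra hne
  have hlt := lt_of_le_of_ne (h.join_le_enter i k) (Ne.symm hne)
  have hcard := hc.trans (h.eager i k _ le_rfl hlt)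
  obtain ⟨⟨⟨j, l⟩, ha, ht⟩⟩ := (Nat.card_pos_iff.1 hcard).1
  have := hfree j l ha.1 ha.2.1
  have := ha.2.2
  dsimp only at *
  omega

/-- For unit capacities the FIFO conditions need only be checked on pairs of positions. -/
theorem IsFIFO.of_unit_capacity (hc : ∀ e, Γ.c e = 1)
    (join_start : ∀ i (h : 0 < (π i).val.length), ex.join i ⟨0, h⟩ = Γ.start i)
    (join_le_enter : ∀ i k, ex.join i k ≤ ex.enter i k)
    (transit : ∀ i (k : Fin (π i).val.length) (h : k.val + 1 < (π i).val.length),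
      ex.join i ⟨k.val + 1, h⟩ = ex.enter i k + Γ.d (edgeAt π i k))
    (no_overtake : ∀ j l i k, Ahead π ex j l i k → ex.enter j l ≤ ex.enter i k)
    (capacity : ∀ p q : Σ i : Fin Γ.n, Fin (π i).val.length,
      edgeAt π p.1 p.2 = edgeAt π q.1 q.2 → ex.enter p.1 p.2 = ex.enter q.1 q.2 → p = q)
    (eager : ∀ i k, ∀ t < ex.enter i k, ex.join i k ≤ t →
      ∃ j l, Ahead π ex j l i k ∧ ex.enter j l = t) :
    IsFIFO π ex where
  join_start := join_start
  join_le_enter := join_le_enter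
  transit := transit
  no_overtake := no_overtake
  capacity e t := by
    rw [hc, Finite.card_le_one_iff_subsingleton]
    exact ⟨fun p q => Subtype.ext
      (capacity _ _ (p.2.1.trans q.2.1.symm) (p.2.2.trans q.2.2.symm))⟩
  eager i k t hj ht := by
    obtain ⟨j, l, ha, he⟩ := eager i k t ht hj
    rw [hc]
    exact Nat.card_pos_iff.2 ⟨⟨⟨⟨j, l⟩, ha, he⟩⟩, inferInstance⟩

/-- The cost of an agent bounds the time at which it enters any edge of its path. -/
theorem IsFIFO.enter_le_start_add_cost (h : IsFIFO π ex) (i : Fin Γ.n)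
    (k : Fin (π i).val.length) : ex.enter i k ≤ Γ.start i + cost π ex i := by
  have key : ∀ m (hm : m < (π i).val.length), ex.enter i ⟨m, hm⟩ + Γ.d (edgeAt π i ⟨m, hm⟩) ≤
      Γ.start i + ∑ j : Fin (π i).val.length with j.val ≤ m,
        (waitTime π ex i j + Γ.d (edgeAt π i j)) := by
    intro m
    induction m with
    | zero =>
      intro hm
      have hs := Finset.single_le_sum
        (s := Finset.univ.filter fun j : Fin (π i).val.length => j.val ≤ 0)
        (f := fun j => waitTime π ex i j + Γ.d (edgeAt π i j))
        (fun _ _ => Nat.zero_le _)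
        (Finset.mem_filter.2 ⟨Finset.mem_univ (⟨0, hm⟩ : Fin (π i).val.length), le_rfl⟩)
      have := h.join_start i hm
      dsimp only [waitTime] at hs ⊢
      omega
    | succ m ih =>
      intro hm
      have hm' : m < (π i).val.length := by omega
      have hsplit : (Finset.univ.filter fun j : Fin (π i).val.length => j.val ≤ m + 1) =
          insert ⟨m + 1, hm⟩ (Finset.univ.filter fun j => j.val ≤ m) := by
        ext j
        simp only [Finset.mem_filter, Finset.mem_univ, true_and, Finset.mem_insert, Fin.ext_iff]
        omega
      rw [hsplit, Finset.sum_insert (by simp)]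
      have := ih hm'
      have := h.transit i ⟨m, hm'⟩ hm
      simp only [waitTime] at *
      omega
  refine (Nat.le_add_right _ _).trans ((key k k.2).trans (Nat.add_le_add_left ?_ _))
  exact Finset.sum_le_sum_of_subset (Finset.filter_subset _ _)

end Dynamics

namespace Pursuit

/-- The vertex at which the evader, the retarders and the messengers join. -/
abbrev hub : Fin 11 := 0

/-- The source of the pursuer. -/
abbrev lair : Fin 11 := 1

/-- The common sink of the pursuer and the evader. -/
abbrev goal : Fin 11 := 2

/-- The junction of a side. -/
abbrev junction (s : Bool) : Fin 11 := cond s 3 4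

/-- The tail of the edge on which the messenger of a side may obstruct the pursuer. -/
abbrev gate (s : Bool) : Fin 11 := cond s 5 6

/-- The head of the edge on which the messenger of a side may obstruct the pursuer. -/
abbrev post (s : Bool) : Fin 11 := cond s 7 8

/-- The source of the messenger of a side. -/
abbrev camp (s : Bool) : Fin 11 := cond s 9 10

/-- The agent that makes the evader wait for one step at the hub. -/
abbrev retarder (s : Bool) : Fin 8 := cond s 0 1

/-- The agent that obstructs the pursuer unless the evader has obstructed it before. -/
abbrev messenger (s : Bool) : Fin 8 := cond s 2 3

/-- The agent that wants to choose the same side as the evader. -/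
abbrev pursuer : Fin 8 := 4

/-- The agent that wants to choose the side the pursuer does not choose. -/
abbrev evader : Fin 8 := 5

/-- The edges of one side of the network. -/
def sideEdges (s : Bool) : Finset (Fin 11 × Fin 11) :=
  {(camp s, hub), (hub, junction s), (junction s, gate s), (gate s, post s),
    (post s, junction s), (junction s, goal), (lair, gate s)}

/-- A pursuer-evader game with two symmetric sides. All agents start at time zero, all edges
have capacity one, and only the edges leaving the lair and the camps have a positive delay.
The last two agents are already at their sink. -/
abbrev game : FROG where
  nV := 11
  E := sideEdges true ∪ sideEdges false
  c _ := 1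
  d e := if e.1 = lair ∨ e.1 = camp true ∨ e.1 = camp false then 1 else 0
  n := 8
  src := ![hub, hub, camp true, camp false, lair, hub, goal, goal]
  sink := ![junction true, junction false, post true, post false, goal, goal, goal, goal]
  start _ := 0
  prio i := i
  prio_inj := Fin.val_injective
  c_pos _ _ := le_rfl

/-- The path of the messenger of side `s`. -/
def messengerPath (s : Bool) : List game.Edge :=
  [(camp s, hub), (hub, junction s), (junction s, gate s), (gate s, post s)]

/-- The paths of all agents if the evader chooses side `s` and the pursuer side `t`. -/
def route (s t : Bool) : Fin 8 → List game.Edge :=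
  ![[(hub, junction true)], [(hub, junction false)], messengerPath true, messengerPath false,
    [(lair, gate t), (gate t, post t), (post t, junction t), (junction t, goal)],
    [(hub, junction s), (junction s, goal)], [], []]

theorem route_isStrat : ∀ (s t : Bool) (i : Fin 8),
    game.IsPathFrom (game.src i) (game.sink i) (route s t i) ∧
      game.IsSimple (game.src i) (route s t i) := by
  intro s t i
  cases s <;> cases t <;> fin_cases i <;> decide +kernel

/-- The profile in which the evader chooses side `s` and the pursuer side `t`. -/
def profile (s t : Bool) : game.Profile := fun i => ⟨route s t i, route_isStrat s t i⟩

theorem evader_strat : ∀ p ∈ game.boundedPaths (game.sink evader) game.nV [] (game.src evader),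
    ∃ s, ∀ t, p = route s t evader := by
  decide +kernel

theorem pursuer_strat :
    ∀ p ∈ game.boundedPaths (game.sink pursuer) game.nV [] (game.src pursuer),
      ∃ t, ∀ s, p = route s t pursuer := by
  decide +kernel

theorem other_strat : ∀ i : Fin 8, i ≠ evader → i ≠ pursuer →
    ∀ p ∈ game.boundedPaths (game.sink i) game.nV [] (game.src i), ∀ s t, p = route s t i := by
  decide +kernel

theorem exists_eq_profile (π : game.Profile) : ∃ s t, π = profile s t := by
  obtain ⟨s, hs⟩ := evader_strat _ (Strat.mem_boundedPaths (π evader))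
  obtain ⟨t, ht⟩ := pursuer_strat _ (Strat.mem_boundedPaths (π pursuer))
  refine ⟨s, t, funext fun i => Subtype.ext ?_⟩
  by_cases he : i = evader
  · subst he
    exact hs t
  by_cases hp : i = pursuer
  · subst hp
    exact ht s
  exact other_strat i he hp _ (Strat.mem_boundedPaths (π i)) s t

theorem update_evader (s s' t : Bool) :
    Function.update (profile s t) evader (profile s' t evader) = profile s' t := by
  have h : ∀ (s s' t : Bool) (i : Fin 8), i ≠ evader → route s t i = route s' t i := by
    decide +kernel
  exact Function.update_eq_iff.2 ⟨rfl, fun i hi => Subtype.ext (h s s' t i hi)⟩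

theorem update_pursuer (s t t' : Bool) :
    Function.update (profile s t) pursuer (profile s t' pursuer) = profile s t' := by
  have h : ∀ (s t t' : Bool) (i : Fin 8), i ≠ pursuer → route s t i = route s t' i := by
    decide +kernel
  exact Function.update_eq_iff.2 ⟨rfl, fun i hi => Subtype.ext (h s t t' i hi)⟩

/-- The waiting time of the messenger of side `u` if the evader chooses side `s`. -/
def messengerWait (s u : Bool) : ℕ := if s = u then 1 else 0

/-- The join times of all agents in `profile s t`. -/
def joinTimes (s t : Bool) : Fin 8 → List ℕ :=
  ![[0], [0], [0, 1, 1 + messengerWait s true, 1 + messengerWait s true],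
    [0, 1, 1 + messengerWait s false, 1 + messengerWait s false],
    if s = t then [0, 1, 1, 1] else [0, 1, 2, 2], [0, 1], [], []]

/-- The enter times of all agents in `profile s t`. -/
def enterTimes (s t : Bool) : Fin 8 → List ℕ :=
  ![[0], [0], [0, 1 + messengerWait s true, 1 + messengerWait s true, 1 + messengerWait s true],
    [0, 1 + messengerWait s false, 1 + messengerWait s false, 1 + messengerWait s false],
    if s = t then [0, 1, 1, 1] else [0, 2, 2, 2], if s = t then [1, 2] else [1, 1], [], []]

/-- The execution of `profile s t`. -/
def execution (s t : Bool) : Execution (profile s t) where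
  join i k := (joinTimes s t i).getD k 0
  enter i k := (enterTimes s t i).getD k 0

theorem execution_isFIFO (s t : Bool) : IsFIFO (profile s t) (execution s t) := by
  refine IsFIFO.of_unit_capacity (fun _ => rfl) ?_ ?_ ?_ ?_ ?_ ?_ <;>
    cases s <;> cases t <;> decide +kernel

theorem le_delay {s t : Bool} {i : Fin 8} {m : ℕ}
    (h : ∀ ex : Execution (profile s t), IsFIFO _ ex → m ≤ cost _ ex i) :
    m ≤ delay (profile s t) i := by
  refine le_csInf ⟨_, execution s t, execution_isFIFO s t, rfl⟩ ?_
  rintro _ ⟨ex, hex, rfl⟩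
  exact h ex hex

theorem delay_le (s t : Bool) (i : Fin 8) :
    delay (profile s t) i ≤ cost _ (execution s t) i :=
  Nat.sInf_le ⟨execution s t, execution_isFIFO s t, rfl⟩

/-- The position of a retarder on its path. -/
def retarderPos (s t u : Bool) : Fin (profile s t (retarder u)).val.length :=
  ⟨0, by cases u <;> exact Nat.zero_lt_one⟩

/-- The positions of a messenger on its path. -/
def messengerPos (s t u : Bool) (k : Fin 4) : Fin (profile s t (messenger u)).val.length :=
  k.cast (by cases u <;> rfl)

/-- The positions of the pursuer on its path. -/
def pursuerPos (s t : Bool) (k : Fin 4) : Fin (profile s t pursuer).val.length := k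

/-- The positions of the evader on its path. -/
def evaderPos (s t : Bool) (k : Fin 2) : Fin (profile s t evader).val.length := k

section

variable {s t : Bool} {ex : Execution (profile s t)}

theorem enter_eq_join_of_unshared (h : IsFIFO (profile s t) ex) {i : Fin 8}
    {k : Fin (profile s t i).val.length}
    (hk : ∀ j l, edgeAt (profile s t) j l = edgeAt (profile s t) i k → j = i ∧ l.val = k.val) :
    ex.enter i k = ex.join i k :=
  h.enter_eq_join le_rfl fun j l he hne => by
    have := hk j l he
    tauto

theorem enter_eq_join_of_shared (h : IsFIFO (profile s t) ex) {i j : Fin 8}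
    {k : Fin (profile s t i).val.length} {l : Fin (profile s t j).val.length}
    (hk : ∀ j' l', edgeAt (profile s t) j' l' = edgeAt (profile s t) i k →
      (j' = i ∧ l'.val = k.val) ∨ (j' = j ∧ l'.val = l.val))
    (hl : ex.join i k < ex.join j l ∨ ex.enter j l < ex.join i k) :
    ex.enter i k = ex.join i k :=
  h.enter_eq_join le_rfl fun j' l' he hne => by
    rcases hk j' l' he with h' | ⟨rfl, h'⟩
    · tauto
    · obtain rfl := Fin.ext h'
      exact hl

theorem join_retarder (h : IsFIFO (profile s t) ex) (u : Bool) :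
    ex.join (retarder u) (retarderPos s t u) = 0 :=
  h.join_start _ _

theorem join_messenger_hub (h : IsFIFO (profile s t) ex) (u : Bool) :
    ex.join (messenger u) (messengerPos s t u 1) = 1 := by
  have hd : ∀ s t u, game.d (edgeAt (profile s t) (messenger u) (messengerPos s t u 0)) = 1 := by
    decide +kernel
  have hu : ∀ s t u j l, edgeAt (profile s t) j l =
      edgeAt (profile s t) (messenger u) (messengerPos s t u 0) →
        j = messenger u ∧ l.val = (messengerPos s t u 0).val := by
    decide +kernel
  have hj : ex.join (messenger u) (messengerPos s t u 0) = 0 := h.join_start _ _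
  have he := enter_eq_join_of_unshared h (hu s t u)
  have ht : ex.join _ (messengerPos s t u 1) = _ :=
    h.transit (messenger u) (messengerPos s t u 0) (messengerPos s t u 1).2
  have := hd s t u
  omega

theorem join_messenger_gate (h : IsFIFO (profile s t) ex) (u : Bool) :
    ex.join (messenger u) (messengerPos s t u 3) =
      ex.enter (messenger u) (messengerPos s t u 1) := by
  have hd : ∀ s t u, game.d (edgeAt (profile s t) (messenger u) (messengerPos s t u 1)) = 0 ∧
      game.d (edgeAt (profile s t) (messenger u) (messengerPos s t u 2)) = 0 := by
    decide +kernel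
  have hu : ∀ s t u j l, edgeAt (profile s t) j l =
      edgeAt (profile s t) (messenger u) (messengerPos s t u 2) →
        j = messenger u ∧ l.val = (messengerPos s t u 2).val := by
    decide +kernel
  have he := enter_eq_join_of_unshared h (hu s t u)
  have h1 : ex.join _ (messengerPos s t u 2) = _ :=
    h.transit (messenger u) (messengerPos s t u 1) (messengerPos s t u 2).2
  have h2 : ex.join _ (messengerPos s t u 3) = _ :=
    h.transit (messenger u) (messengerPos s t u 2) (messengerPos s t u 3).2
  have := hd s t u
  omega

theorem join_pursuer_gate (h : IsFIFO (profile s t) ex) :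
    ex.join pursuer (pursuerPos s t 1) = 1 := by
  have hu : ∀ s t j l, edgeAt (profile s t) j l = edgeAt (profile s t) pursuer (pursuerPos s t 0) →
      j = pursuer ∧ l.val = (pursuerPos s t 0).val := by
    decide +kernel
  have hj : ex.join pursuer (pursuerPos s t 0) = 0 := h.join_start _ _
  have he := enter_eq_join_of_unshared h (hu s t)
  have ht : ex.join _ (pursuerPos s t 1) = _ :=
    h.transit pursuer (pursuerPos s t 0) (pursuerPos s t 1).2
  have hd : game.d (edgeAt (profile s t) pursuer (pursuerPos s t 0)) = 1 := rfl
  omega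

theorem join_pursuer_junction (h : IsFIFO (profile s t) ex) :
    ex.join pursuer (pursuerPos s t 3) = ex.enter pursuer (pursuerPos s t 1) := by
  have hd : ∀ s t, game.d (edgeAt (profile s t) pursuer (pursuerPos s t 1)) = 0 ∧
      game.d (edgeAt (profile s t) pursuer (pursuerPos s t 2)) = 0 := by
    decide +kernel
  have hu : ∀ s t j l, edgeAt (profile s t) j l = edgeAt (profile s t) pursuer (pursuerPos s t 2) →
      j = pursuer ∧ l.val = (pursuerPos s t 2).val := by
    decide +kernel
  have he := enter_eq_join_of_unshared h (hu s t)
  have h1 : ex.join _ (pursuerPos s t 2) = _ :=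
    h.transit pursuer (pursuerPos s t 1) (pursuerPos s t 2).2
  have h2 : ex.join _ (pursuerPos s t 3) = _ :=
    h.transit pursuer (pursuerPos s t 2) (pursuerPos s t 3).2
  have := hd s t
  omega

end

/-- If both choose the same side, the evader leaves the hub just before the messenger, which
is therefore late at the gate, so that the pursuer reaches the junction in time to obstruct
the evader. -/
theorem two_le_cost_evader {s : Bool} {ex : Execution (profile s s)}
    (h : IsFIFO (profile s s) ex) : 2 ≤ cost _ ex evader := by
  have hub_edge : ∀ s,
      edgeAt (profile s s) (retarder s) (retarderPos s s s) =
        edgeAt (profile s s) evader (evaderPos s s 0) ∧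
      edgeAt (profile s s) evader (evaderPos s s 0) =
        edgeAt (profile s s) (messenger s) (messengerPos s s s 1) ∧
      retarder s < evader ∧ evader ≠ messenger s := by
    decide +kernel
  obtain ⟨hre, hem, hlt, hne⟩ := hub_edge s
  have evader_start : ex.join evader (evaderPos s s 0) = 0 := h.join_start _ _
  have evader_waits := h.enter_lt_of_ahead rfl
    ⟨hre, Or.inl hlt.ne, Or.inr ⟨(join_retarder h s).trans evader_start.symm, hlt⟩⟩
  have hm := join_messenger_hub h s
  have messenger_waits := h.enter_lt_of_ahead rfl
    ⟨hem, Or.inl hne, Or.inl (by omega)⟩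
  have messenger_late := join_messenger_gate h s
  have gate_edge : ∀ s j l, edgeAt (profile s s) j l =
      edgeAt (profile s s) pursuer (pursuerPos s s 1) →
        (j = pursuer ∧ l.val = (pursuerPos s s 1).val) ∨
          (j = messenger s ∧ l.val = (messengerPos s s s 3).val) := by
    decide +kernel
  have pursuer_gate := join_pursuer_gate h
  have pursuer_free := enter_eq_join_of_shared h (gate_edge s) (Or.inl (by omega))
  have pursuer_junction := join_pursuer_junction h
  have evader_junction : ex.join _ (evaderPos s s 1) = _ + 0 :=
    h.transit evader (evaderPos s s 0) (evaderPos s s 1).2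
  have evader_blocked := h.enter_lt_of_ahead (j := pursuer) (l := pursuerPos s s 3)
    (i := evader) (k := evaderPos s s 1) rfl
    ⟨rfl, Or.inl (by decide), by
      rcases Nat.lt_or_ge (ex.join pursuer (pursuerPos s s 3))
        (ex.join evader (evaderPos s s 1)) with hlt | hge
      · exact Or.inl hlt
      · exact Or.inr ⟨by omega, by decide⟩⟩
  have := h.join_le_enter pursuer (pursuerPos s s 3)
  have hcost : _ ≤ 0 + _ := h.enter_le_start_add_cost evader (evaderPos s s 1)
  omega

/-- If the evader chooses the other side, the messenger reaches the gate in time to obstruct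
the pursuer. -/
theorem two_le_cost_pursuer {t : Bool} {ex : Execution (profile (!t) t)}
    (h : IsFIFO (profile (!t) t) ex) : 2 ≤ cost _ ex pursuer := by
  have retarder_edge : ∀ t j l, edgeAt (profile (!t) t) j l =
      edgeAt (profile (!t) t) (retarder t) (retarderPos (!t) t t) →
        (j = retarder t ∧ l.val = (retarderPos (!t) t t).val) ∨
          (j = messenger t ∧ l.val = (messengerPos (!t) t t 1).val) := by
    decide +kernel
  have messenger_edge : ∀ t j l, edgeAt (profile (!t) t) j l =
      edgeAt (profile (!t) t) (messenger t) (messengerPos (!t) t t 1) →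
        (j = messenger t ∧ l.val = (messengerPos (!t) t t 1).val) ∨
          (j = retarder t ∧ l.val = (retarderPos (!t) t t).val) := by
    decide +kernel
  have gate_edge : ∀ t, edgeAt (profile (!t) t) (messenger t) (messengerPos (!t) t t 3) =
      edgeAt (profile (!t) t) pursuer (pursuerPos (!t) t 1) ∧ messenger t < pursuer := by
    decide +kernel
  have hr := join_retarder h t
  have hm := join_messenger_hub h t
  have retarder_free := enter_eq_join_of_shared h (retarder_edge t) (Or.inl (by omega))
  have messenger_free := enter_eq_join_of_shared h (messenger_edge t) (Or.inr (by omega))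
  have messenger_gate := join_messenger_gate h t
  have pursuer_gate := join_pursuer_gate h
  obtain ⟨hedge, hlt⟩ := gate_edge t
  have pursuer_blocked := h.enter_lt_of_ahead rfl
    ⟨hedge, Or.inl hlt.ne, Or.inr ⟨by omega, hlt⟩⟩
  have := h.join_le_enter (messenger t) (messengerPos (!t) t t 3)
  have hcost : _ ≤ 0 + _ := h.enter_le_start_add_cost pursuer (pursuerPos (!t) t 1)
  omega

theorem cost_evader_le : ∀ s, cost _ (execution (!s) s) evader ≤ 1 := by
  decide +kernel

theorem cost_pursuer_le : ∀ t, cost _ (execution t t) pursuer ≤ 1 := by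
  decide +kernel

theorem not_isPNE (π : game.Profile) : ¬ IsPNE π := by
  intro hπ
  obtain ⟨s, t, rfl⟩ := exists_eq_profile π
  by_cases hst : s = t
  · subst hst
    have hdev := hπ evader (profile (!s) s evader)
    rw [update_evader] at hdev
    have := le_delay fun ex (h : IsFIFO (profile s s) ex) => two_le_cost_evader h
    have := (delay_le (!s) s evader).trans (cost_evader_le s)
    omega
  · obtain rfl : s = !t := Bool.eq_not.2 hst
    have hdev := hπ pursuer (profile (!t) (!t) pursuer)
    rw [update_pursuer] at hdev
    have := le_delay fun ex (h : IsFIFO (profile (!t) t) ex) => two_le_cost_pursuer h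
    have := (delay_le (!t) (!t) pursuer).trans (cost_pursuer_le (!t))
    omega

end Pursuit

end FROG

/-- There exists a First-in-first-out Routing Game that
admits no pure Nash equilibrium: in particular an 8-agent game (the
pursuer–evader construction of Fig. 2) in which strategy profiles exist but no
strategy profile is such that no agent can strictly improve its total delay by
a unilateral deviation. -/
theorem exists_frog_without_pne :
    ∃ Γ : FROG, Γ.n = 8 ∧ Nonempty Γ.Profile ∧ ∀ π : Γ.Profile, ¬ FROG.IsPNE π := by
  exact ⟨FROG.Pursuit.game, rfl, ⟨FROG.Pursuit.profile true true⟩, FROG.Pursuit.not_isPNE⟩
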